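/- Let k ≥ 0, m,n ∈ ℕ, and let x ∈ A(S^7_q) ⊗_B A(S^7_q) satisfy χ(x) = 1 ⊗ r^{k,m,n}. Then χ(q^{2+m+n} z_1* x z_1 + q^{2+m+n} z_2 x z_2* + q^2 z_3 x z_3* + z_4* x z_4) = 1 ⊗ r^{k+1,m,n}, where products are taken in the A(S^7_q)-bimodule A(S^7_q) ⊗_B A(S^7_q). -/

import Mathlib

open scoped TensorProduct

noncomputable section

namespace QIB

/-- Generators of `A(U_q(4))`: the matrix entries `t i j` and the extra generator `D_q⁻¹`. -/
abbrev genU : Type := (Fin 4 × Fin 4) ⊕ Unit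

abbrev FU : Type := FreeAlgebra ℂ genU

def T (i j : Fin 4) : FU := FreeAlgebra.ι ℂ (Sum.inl (i, j))

def Dinv0 : FU := FreeAlgebra.ι ℂ (Sum.inr ())

/-- The length (number of inversions) of a permutation of `Fin 4`. -/
def plen (σ : Equiv.Perm (Fin 4)) : ℕ :=
  ((Finset.univ : Finset (Fin 4 × Fin 4)).filter fun p => p.1 < p.2 ∧ σ p.2 < σ p.1).card

/-- The quantum determinant, as an element of the free algebra. -/
def Dq0 (q : ℝ) : FU :=
  ∑ σ : Equiv.Perm (Fin 4),
    ((-(q : ℂ)) ^ plen σ) • (T (σ 0) 0 * T (σ 1) 1 * T (σ 2) 2 * T (σ 3) 3)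

/-- The defining relations of `A(U_q(4))`. -/
inductive relU (q : ℝ) : FU → FU → Prop
  | col {i j k : Fin 4} : i < j → relU q (T i k * T j k) ((q : ℂ) • (T j k * T i k))
  | row {i j k : Fin 4} : i < j → relU q (T k i * T k j) ((q : ℂ) • (T k j * T k i))
  | comm {i j k l : Fin 4} : i < j → k < l → relU q (T i l * T j k) (T j k * T i l)
  | qcom {i j k l : Fin 4} : i < j → k < l →
      relU q (T i k * T j l - T j l * T i k) (((q : ℂ) - (q : ℂ)⁻¹) • (T j k * T i l))
  | dr : relU q (Dq0 q * Dinv0) 1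
  | dl : relU q (Dinv0 * Dq0 q) 1

variable (q : ℝ)

/-- The algebra `A(U_q(4))`. -/
abbrev AU : Type := RingQuot (relU q)

/-- The generators `t i j` of `A(U_q(4))` (indices are 0-based). -/
def tt (i j : Fin 4) : AU q := RingQuot.mkAlgHom ℂ (relU q) (T i j)

/-- The generator `D_q⁻¹`. -/
def dI : AU q := RingQuot.mkAlgHom ℂ (relU q) Dinv0

/-- The quantum determinant `D_q` in `A(U_q(4))`. -/
def Dq : AU q := RingQuot.mkAlgHom ℂ (relU q) (Dq0 q)

/-- The spanning set `R` of relation elements (0-based indices). -/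
def Rset : Set (AU q) :=
  {tt q 0 2, tt q 2 0, tt q 0 3, tt q 3 0, tt q 1 3, tt q 3 1, tt q 1 2, tt q 2 1,
   tt q 0 0 - tt q 3 3, tt q 0 1 + tt q 3 2, tt q 1 0 + tt q 2 3, tt q 1 1 - tt q 2 2,
   tt q 0 0 * tt q 1 1 - (q : ℂ) • (tt q 0 1 * tt q 1 0) - 1}

/-- The right ideal `ℛ = R · A(U_q(4))`, as a `ℂ`-submodule. -/
def RIdeal : Submodule ℂ (AU q) :=
  Submodule.span ℂ {y | ∃ x ∈ Rset q, ∃ a : AU q, y = x * a}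

/-- The coalgebra `C = A(U_q(4)) / ℛ`. -/
abbrev Cq : Type := AU q ⧸ RIdeal q

/-- The canonical projection `r : A(U_q(4)) → C`. -/
def rr : AU q →ₗ[ℂ] Cq q := (RIdeal q).mkQ

lemma RIdeal_mul_right {y : AU q} (hy : y ∈ RIdeal q) (c : AU q) : y * c ∈ RIdeal q := by
  induction hy using Submodule.span_induction with
  | mem x hx =>
      obtain ⟨x0, hx0, a, rfl⟩ := hx
      exact Submodule.subset_span ⟨x0, hx0, a * c, by rw [mul_assoc]⟩
  | zero => simp
  | add u v _ _ hu hv => simpa [add_mul] using (RIdeal q).add_mem hu hv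
  | smul a u _ hu => simpa [smul_mul_assoc] using (RIdeal q).smul_mem a hu

/-- Auxiliary map for the right `A(U_q(4))`-module structure of `C`:
right multiplication by `c` descends to the quotient. -/
def cactAux (c : AU q) : Cq q →ₗ[ℂ] Cq q :=
  Submodule.liftQ (RIdeal q) ((RIdeal q).mkQ ∘ₗ LinearMap.mulRight ℂ c)
    (by
      intro y hy
      simp only [LinearMap.mem_ker, LinearMap.comp_apply, LinearMap.mulRight_apply,
        Submodule.mkQ_apply, Submodule.Quotient.mk_eq_zero]
      exact RIdeal_mul_right q hy c)

@[simp] lemma cactAux_mk (c a : AU q) :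
    cactAux q c (Submodule.Quotient.mk a) = (Submodule.Quotient.mk (a * c) : Cq q) := by
  simp [cactAux]

/-- The right `A(U_q(4))`-module structure `r(t) · t' := r(t t')` of `C`,
as a bilinear map `A(U_q(4)) →ₗ C →ₗ C`, `(c, x) ↦ x · c`. -/
def cact : AU q →ₗ[ℂ] Cq q →ₗ[ℂ] Cq q where
  toFun c := cactAux q c
  map_add' c c' := by
    refine LinearMap.ext fun x => ?_
    obtain ⟨a, rfl⟩ := Submodule.Quotient.mk_surjective _ x
    simp only [cactAux_mk, mul_add, Submodule.Quotient.mk_add, LinearMap.add_apply]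
  map_smul' s c := by
    refine LinearMap.ext fun x => ?_
    obtain ⟨a, rfl⟩ := Submodule.Quotient.mk_surjective _ x
    simp only [cactAux_mk, mul_smul_comm, Submodule.Quotient.mk_smul, RingHom.id_apply, LinearMap.smul_apply]

@[simp] lemma cact_mk (c a : AU q) : cact q c (rr q a) = rr q (a * c) := by
  simp [cact, rr]

/-- θ(k) = 1 for k ≥ 0 and 0 for k < 0. -/
def thetaZ (k : ℤ) : ℂ := if 0 ≤ k then 1 else 0

/-- The linear basis elements `r^{k,m,n}` of `C`, given as representatives in `A(U_q(4))`. -/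
def bas (k : ℤ) (m n : ℕ) : AU q :=
  if 0 ≤ k then tt q 0 0 ^ k.toNat * tt q 0 1 ^ m * tt q 1 0 ^ n
  else tt q 0 1 ^ m * tt q 1 0 ^ n * tt q 1 1 ^ (-k).toNat

/-! ### The quantum seven-sphere -/

/-- Generators of `A(S⁷_q)`: `(i, false)` is `z_i`, `(i, true)` is `z_i^*`. -/
abbrev genS : Type := Fin 4 × Bool

abbrev FS : Type := FreeAlgebra ℂ genS

def Z0 (i : Fin 4) : FS := FreeAlgebra.ι ℂ (i, false)

def Zs0 (i : Fin 4) : FS := FreeAlgebra.ι ℂ (i, true)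

/-- The defining relations of the ∗-algebra `A(S⁷_q)` (including the ∗-conjugate of the
first family of relations, so that the relation set is closed under the involution). -/
inductive relS (q : ℝ) : FS → FS → Prop
  | zz {i j : Fin 4} : i < j → relS q (Z0 i * Z0 j) ((q : ℂ) • (Z0 j * Z0 i))
  | ss {i j : Fin 4} : i < j → relS q (Zs0 j * Zs0 i) ((q : ℂ) • (Zs0 i * Zs0 j))
  | sz {i j : Fin 4} : i ≠ j → relS q (Zs0 j * Z0 i) ((q : ℂ) • (Z0 i * Zs0 j))
  | szz {k : Fin 4} : relS q (Zs0 k * Z0 k)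
      (Z0 k * Zs0 k + (1 - (q : ℂ) ^ 2) •
        ∑ j ∈ Finset.univ.filter (· < k), Z0 j * Zs0 j)
  | sum1 : relS q (∑ k : Fin 4, Z0 k * Zs0 k) 1

/-- The algebra `P = A(S⁷_q)`. -/
abbrev PA : Type := RingQuot (relS q)

/-- The generators `z_i` of `A(S⁷_q)` (0-based index). -/
def z (i : Fin 4) : PA q := RingQuot.mkAlgHom ℂ (relS q) (Z0 i)

/-- The generators `z_i^*` of `A(S⁷_q)` (0-based index). -/
def zs (i : Fin 4) : PA q := RingQuot.mkAlgHom ℂ (relS q) (Zs0 i)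

/-- The element `R = z₁ z₁^* + z₂ z₂^*` of `A(S⁷_q)`. -/
def RRe [StarRing (PA q)] : PA q := z q 0 * star (z q 0) + z q 1 * star (z q 1)

/-- The element `a = z₁ z₄^* − z₂ z₃^*` of `A(S⁷_q)`. -/
def aa [StarRing (PA q)] : PA q := z q 0 * star (z q 3) - z q 1 * star (z q 2)

/-- The element `b = z₁ z₃ + q⁻¹ z₂ z₄` of `A(S⁷_q)`. -/
def bb : PA q := z q 0 * z q 2 + (q : ℂ)⁻¹ • (z q 1 * z q 3)

/-- The elements `a_n = z₁ z₄^* − qⁿ z₂ z₃^*` of `A(S⁷_q)`. -/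
def aN [StarRing (PA q)] (n : ℤ) : PA q :=
  z q 0 * star (z q 3) - ((q : ℂ) ^ n) • (z q 1 * star (z q 2))

/-- The elements `b_n = z₁ z₃ + q^{n−1} z₂ z₄` of `A(S⁷_q)`. -/
def bN (n : ℤ) : PA q := z q 0 * z q 2 + ((q : ℂ) ^ (n - 1)) • (z q 1 * z q 3)

/-! ### The coaction, the coinvariants and the canonical map -/

variable (δ : PA q →ₐ[ℂ] PA q ⊗[ℂ] AU q)

/-- `Δ_r := (id ⊗ r) ∘ Δ : A(S⁷_q) → A(S⁷_q) ⊗ C`, built from the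
`A(U_q(4))`-coaction `δ`. -/
def Dr : PA q →ₗ[ℂ] PA q ⊗[ℂ] Cq q :=
  (LinearMap.lTensor (PA q) (rr q)) ∘ₗ δ.toLinearMap

/-- The set of coinvariants `B = A(Σ⁴_q) = {a | Δ_r(a) = a ⊗ r(1)}`. -/
def Bset : Set (PA q) := {a : PA q | Dr q δ a = a ⊗ₜ[ℂ] rr q 1}

/-- The subspace of `P ⊗ P` spanned by the elements `(u b) ⊗ v − u ⊗ (b v)` with `b`
a coinvariant; quotienting by it produces the balanced tensor product `P ⊗_B P`. -/
def relT : Submodule ℂ (PA q ⊗[ℂ] PA q) :=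
  Submodule.span ℂ
    {x : PA q ⊗[ℂ] PA q | ∃ u v b : PA q, b ∈ Bset q δ ∧
      x = (u * b) ⊗ₜ[ℂ] v - u ⊗ₜ[ℂ] (b * v)}

instance : AddCommGroup (PA q ⊗[ℂ] PA q) := TensorProduct.addCommGroup

/-- The balanced tensor product `P ⊗_B P` over the coinvariant subalgebra `B = A(Σ⁴_q)`. -/
abbrev PBP : Type := (PA q ⊗[ℂ] PA q) ⧸ relT q δ

/-- The canonical projection `P ⊗ P → P ⊗_B P`. -/
def mkT : PA q ⊗[ℂ] PA q →ₗ[ℂ] PBP q δ := (relT q δ).mkQ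

lemma relT_map_lmul (p : PA q) {x : PA q ⊗[ℂ] PA q} (hx : x ∈ relT q δ) :
    TensorProduct.map (LinearMap.mulLeft ℂ p) LinearMap.id x ∈ relT q δ := by
  induction hx using Submodule.span_induction with
  | mem y hy =>
      obtain ⟨u, v, b, hb, rfl⟩ := hy
      refine Submodule.subset_span ⟨p * u, v, b, hb, ?_⟩
      simp [TensorProduct.map_tmul, mul_assoc]
  | zero => simp
  | add u v _ _ hu hv => simpa [map_add] using Submodule.add_mem _ hu hv
  | smul a u _ hu => simpa [map_smul] using Submodule.smul_mem _ a hu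

lemma relT_map_rmul (p : PA q) {x : PA q ⊗[ℂ] PA q} (hx : x ∈ relT q δ) :
    TensorProduct.map LinearMap.id (LinearMap.mulRight ℂ p) x ∈ relT q δ := by
  induction hx using Submodule.span_induction with
  | mem y hy =>
      obtain ⟨u, v, b, hb, rfl⟩ := hy
      refine Submodule.subset_span ⟨u, v * p, b, hb, ?_⟩
      simp [TensorProduct.map_tmul, mul_assoc]
  | zero => simp
  | add u v _ _ hu hv => simpa [map_add] using Submodule.add_mem _ hu hv
  | smul a u _ hu => simpa [map_smul] using Submodule.smul_mem _ a hu

/-- Left multiplication by `p ∈ P` on the bimodule `P ⊗_B P`. -/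
def lact (p : PA q) : PBP q δ →ₗ[ℂ] PBP q δ :=
  Submodule.liftQ (relT q δ)
    ((relT q δ).mkQ ∘ₗ TensorProduct.map (LinearMap.mulLeft ℂ p) LinearMap.id)
    (by
      intro x hx
      simp only [LinearMap.mem_ker, LinearMap.comp_apply, Submodule.mkQ_apply,
        Submodule.Quotient.mk_eq_zero]
      exact relT_map_lmul q δ p hx)

/-- Right multiplication by `p ∈ P` on the bimodule `P ⊗_B P`. -/
def ract (p : PA q) : PBP q δ →ₗ[ℂ] PBP q δ :=
  Submodule.liftQ (relT q δ)
    ((relT q δ).mkQ ∘ₗ TensorProduct.map LinearMap.id (LinearMap.mulRight ℂ p))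
    (by
      intro x hx
      simp only [LinearMap.mem_ker, LinearMap.comp_apply, Submodule.mkQ_apply,
        Submodule.Quotient.mk_eq_zero]
      exact relT_map_rmul q δ p hx)

/-- The structure map of the right action `◁` of `A(S⁷_q)` on `A(S⁷_q) ⊗ C`:
on simple tensors, `(u ⊗ x) ⊗ (w ⊗ y) ↦ (u w) ⊗ (x · y)`.  The action is
`(u ⊗ x) ◁ v = triMap ((u ⊗ x) ⊗ δ v) = Σ u v₍₀₎ ⊗ x · v₍₁₎`. -/
def triMap : (PA q ⊗[ℂ] Cq q) ⊗[ℂ] (PA q ⊗[ℂ] AU q) →ₗ[ℂ] PA q ⊗[ℂ] Cq q :=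
  (TensorProduct.map (LinearMap.mul' ℂ (PA q)) (TensorProduct.lift (LinearMap.flip (cact q)))) ∘ₗ
    (TensorProduct.tensorTensorTensorComm ℂ (PA q) (Cq q) (PA q) (AU q)).toLinearMap

/-- The FRT relations, in the uniform form given by the `R`-matrix. -/
def IsFRT {A : Type*} [Ring A] [Algebra ℂ A] (q : ℂ) (t : Fin 4 → Fin 4 → A) : Prop :=
  ∀ i j k l : Fin 4,
    (if i = j then q else 1) • (t i k * t j l) + (if j < i then q - q⁻¹ else 0) • (t j k * t i l)
      = (if k = l then q else 1) • (t j l * t i k) + (if k < l then q - q⁻¹ else 0) • (t j k * t i l)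

section Abstract

variable {A : Type*} [Ring A] [Algebra ℂ A] {q : ℂ} {t s : Fin 4 → Fin 4 → A}

/-- The mixed commutation relations between `t` and its inverse matrix `s`. -/
lemma mixed (h : IsFRT q t)
    (hl : ∀ i j : Fin 4, ∑ k : Fin 4, s i k * t k j = if i = j then 1 else 0)
    (hr : ∀ i j : Fin 4, ∑ k : Fin 4, t i k * s k j = if i = j then 1 else 0)
    (i k j l : Fin 4) :
    (if i = l then q else 1) • (s j l * t i k)
        + (if i = l then ∑ a : Fin 4, (if a < i then q - q⁻¹ else 0) • (s j a * t a k) else 0)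
      = (if k = j then q else 1) • (t i k * s j l)
        + (if j = k then ∑ a : Fin 4, (if k < a then q - q⁻¹ else 0) • (t i a * s a l) else 0) := by
  have key : ∑ c : Fin 4, ∑ d : Fin 4, s j c * ((if i = c then q else 1) • (t i k * t c d)
        + (if c < i then q - q⁻¹ else 0) • (t c k * t i d)) * s d l
      = ∑ c : Fin 4, ∑ d : Fin 4, s j c * ((if k = d then q else 1) • (t c d * t i k)
        + (if k < d then q - q⁻¹ else 0) • (t c k * t i d)) * s d l := by
    refine Finset.sum_congr rfl fun c _ => Finset.sum_congr rfl fun d _ => ?_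
    rw [h i c k d]
  have e1 : ∑ c : Fin 4, ∑ d : Fin 4, s j c * ((if i = c then q else 1) • (t i k * t c d)
        + (if c < i then q - q⁻¹ else 0) • (t c k * t i d)) * s d l
      = ∑ c : Fin 4, ((if i = c then q else 1) • (s j c * t i k * (∑ d : Fin 4, t c d * s d l))
        + (if c < i then q - q⁻¹ else 0) • (s j c * t c k * (∑ d : Fin 4, t i d * s d l))) := by
    refine Finset.sum_congr rfl fun c _ => ?_
    simp only [Finset.mul_sum, Finset.smul_sum, ← Finset.sum_add_distrib]
    refine Finset.sum_congr rfl fun d _ => ?_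
    simp only [mul_add, add_mul, mul_smul_comm, smul_mul_assoc, mul_assoc]
  have e2 : ∑ c : Fin 4, ∑ d : Fin 4, s j c * ((if k = d then q else 1) • (t c d * t i k)
        + (if k < d then q - q⁻¹ else 0) • (t c k * t i d)) * s d l
      = ∑ d : Fin 4, ((if k = d then q else 1) • ((∑ c : Fin 4, s j c * t c d) * t i k * s d l)
        + (if k < d then q - q⁻¹ else 0) • ((∑ c : Fin 4, s j c * t c k) * t i d * s d l)) := by
    rw [Finset.sum_comm]
    refine Finset.sum_congr rfl fun c _ => ?_
    simp only [Finset.sum_mul, Finset.smul_sum, ← Finset.sum_add_distrib]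
    refine Finset.sum_congr rfl fun d _ => ?_
    simp only [mul_add, add_mul, mul_smul_comm, smul_mul_assoc, mul_assoc]
  rw [e1, e2] at key
  simp only [hl, hr, Finset.sum_add_distrib, mul_ite, ite_mul, mul_one, one_mul, mul_zero,
    zero_mul, smul_ite, smul_zero, Finset.sum_ite_eq, Finset.sum_ite_eq', Finset.mem_univ,
    if_true] at key
  have f1 : (∑ x : Fin 4, if i = l then (if x < i then q - q⁻¹ else 0) • (s j x * t x k) else 0)
      = (if i = l then ∑ a : Fin 4, (if a < i then q - q⁻¹ else 0) • (s j a * t a k) else 0) := by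
    split_ifs <;> simp
  have f2 : (∑ x : Fin 4, if j = k then (if k < x then q - q⁻¹ else 0) • (t i x * s x l) else 0)
      = (if j = k then ∑ a : Fin 4, (if k < a then q - q⁻¹ else 0) • (t i a * s a l) else 0) := by
    split_ifs <;> simp
  rw [f1, f2] at key
  exact key

/-- The generators of the auxiliary right ideal. -/
def Gset (t s : Fin 4 → Fin 4 → A) : Set A :=
  {t 0 2, t 0 3, t 1 2, t 1 3, t 2 0, t 3 0, s 2 0, s 2 1, s 1 2, s 1 3}

/-- An auxiliary right ideal stable under left multiplication by `t 0 0`, `t 0 1`, `t 1 0`. -/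
def MI (t s : Fin 4 → Fin 4 → A) : Submodule ℂ A :=
  Submodule.span ℂ {y | ∃ x ∈ Gset t s, ∃ a : A, y = x * a}

lemma MI_gen {g : A} (hg : g ∈ Gset t s) (a : A) : g * a ∈ MI t s :=
  Submodule.subset_span ⟨g, hg, a, rfl⟩

lemma MI_right {y : A} (hy : y ∈ MI t s) (c : A) : y * c ∈ MI t s := by
  induction hy using Submodule.span_induction with
  | mem x hx =>
      obtain ⟨x0, hx0, a, rfl⟩ := hx
      exact Submodule.subset_span ⟨x0, hx0, a * c, by rw [mul_assoc]⟩
  | zero => simp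
  | add u v _ _ hu hv => simpa [add_mul] using (MI t s).add_mem hu hv
  | smul a u _ hu => simpa [smul_mul_assoc] using (MI t s).smul_mem a hu

lemma MI_left_of {x : A} (hx : ∀ g ∈ Gset t s, x * g ∈ MI t s) {y : A} (hy : y ∈ MI t s) :
    x * y ∈ MI t s := by
  induction hy using Submodule.span_induction with
  | mem u hu =>
      obtain ⟨g, hg, a, rfl⟩ := hu
      rw [← mul_assoc]
      exact MI_right (hx g hg) a
  | zero => simp
  | add u v _ _ hu hv => simpa [mul_add] using (MI t s).add_mem hu hv
  | smul a u _ hu => simpa [mul_smul_comm] using (MI t s).smul_mem a hu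

lemma MI_le {I : Submodule ℂ A} (h : ∀ g ∈ Gset t s, ∀ a, g * a ∈ I) : MI t s ≤ I := by
  refine Submodule.span_le.2 ?_
  rintro _ ⟨g, hg, a, rfl⟩
  exact h g hg a

lemma MI_mem1 {x g a : A} (c : ℂ) (hg : g ∈ Gset t s) (h : x = c • (g * a)) : x ∈ MI t s := by
  rw [h]; exact (MI t s).smul_mem _ (MI_gen hg a)

lemma MI_mem2 {x g a g' a' : A} (c c' : ℂ) (hg : g ∈ Gset t s) (hg' : g' ∈ Gset t s)
    (h : x = c • (g * a) + c' • (g' * a')) : x ∈ MI t s := by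
  rw [h]; exact (MI t s).add_mem ((MI t s).smul_mem _ (MI_gen hg a))
    ((MI t s).smul_mem _ (MI_gen hg' a'))

lemma MI_mem3 {x g a g' a' g'' a'' : A} (c c' c'' : ℂ) (hg : g ∈ Gset t s) (hg' : g' ∈ Gset t s)
    (hg'' : g'' ∈ Gset t s)
    (h : x = c • (g * a) + c' • (g' * a') + c'' • (g'' * a'')) : x ∈ MI t s := by
  rw [h]; exact (MI t s).add_mem ((MI t s).add_mem ((MI t s).smul_mem _ (MI_gen hg a))
    ((MI t s).smul_mem _ (MI_gen hg' a'))) ((MI t s).smul_mem _ (MI_gen hg'' a''))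

lemma frt_row
    (hq : q ≠ 0)
    (h : IsFRT q t)
    {i k l : Fin 4} (hkl : k < l) : t i k * t i l = q • (t i l * t i k) := by
  have := h i i k l
  simp only [if_true, lt_irrefl, if_false, hkl, hkl.ne, zero_smul, add_zero, one_smul] at this
  have e : t i l * t i k = q⁻¹ • (t i k * t i l) := by
    linear_combination (norm := module) (-1 : ℂ) • this
  rw [e, smul_smul, mul_inv_cancel₀ hq, one_smul]

lemma frt_col
    (h : IsFRT q t)
    {i j k : Fin 4} (hij : i < j) : t i k * t j k = q • (t j k * t i k) := by
  have := h i j k k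
  simpa [hij.ne, hij.not_gt] using this

lemma frt_comm
    (h : IsFRT q t)
    {i j k l : Fin 4} (hij : i < j) (hkl : k < l) : t i l * t j k = t j k * t i l := by
  have := h i j l k
  simpa [hij.ne, hij.not_gt, hkl.ne', hkl.not_gt] using this

lemma frt_q
    (h : IsFRT q t)
    {i j k l : Fin 4} (hij : i < j) (hkl : k < l) :
    t i k * t j l = t j l * t i k + (q - q⁻¹) • (t j k * t i l) := by
  have := h i j k l
  simpa [hij.ne, hij.not_gt, hkl.ne, hkl] using this

lemma mixed00
    (h : IsFRT q t)
    (hl : ∀ i j : Fin 4, ∑ k : Fin 4, s i k * t k j = if i = j then 1 else 0)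
    (hr : ∀ i j : Fin 4, ∑ k : Fin 4, t i k * s k j = if i = j then 1 else 0)
    (j l : Fin 4) (hj : j ≠ 0) :
    t 0 0 * s j l = (if l = 0 then q else 1) • (s j l * t 0 0) := by
  have := mixed h hl hr 0 0 j l
  fin_cases l <;> simp_all [Fin.sum_univ_four, hj.symm]

lemma mixed01
    (h : IsFRT q t)
    (hl : ∀ i j : Fin 4, ∑ k : Fin 4, s i k * t k j = if i = j then 1 else 0)
    (hr : ∀ i j : Fin 4, ∑ k : Fin 4, t i k * s k j = if i = j then 1 else 0)
    (l : Fin 4) :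
    t 0 1 * s 2 l = (if l = 0 then q else 1) • (s 2 l * t 0 1) := by
  have := mixed h hl hr 0 1 2 l
  fin_cases l <;> simp_all [Fin.sum_univ_four]

lemma mixed01'
    (hq : q ≠ 0)
    (h : IsFRT q t)
    (hl : ∀ i j : Fin 4, ∑ k : Fin 4, s i k * t k j = if i = j then 1 else 0)
    (hr : ∀ i j : Fin 4, ∑ k : Fin 4, t i k * s k j = if i = j then 1 else 0)
    (l : Fin 4) :
    t 0 1 * s 1 l = (if l = 0 then 1 else q⁻¹) • (s 1 l * t 0 1)
      - (q⁻¹ * (q - q⁻¹)) • (t 0 2 * s 2 l + t 0 3 * s 3 l) := by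
  have := mixed h hl hr 0 1 1 l
  have e : t 0 1 * s 1 l = q⁻¹ • (q • (t 0 1 * s 1 l)) := by
    rw [smul_smul, inv_mul_cancel₀ hq, one_smul]
  rw [e]
  fin_cases l <;> simp [Fin.sum_univ_four] at this ⊢
  · have e2 : s 1 0 * t 0 1 = q⁻¹ • (q • (s 1 0 * t 0 1)) := by
      rw [smul_smul, inv_mul_cancel₀ hq, one_smul]
    rw [e2, this]; module
  all_goals rw [this]; module

lemma mixed10
    (h : IsFRT q t)
    (hl : ∀ i j : Fin 4, ∑ k : Fin 4, s i k * t k j = if i = j then 1 else 0)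
    (hr : ∀ i j : Fin 4, ∑ k : Fin 4, t i k * s k j = if i = j then 1 else 0)
    (j l : Fin 4) (hj : j ≠ 0) (hl1 : l ≠ 1):
    t 1 0 * s j l = s j l * t 1 0 := by
  have := mixed h hl hr 1 0 j l
  simp_all [hj.symm, hl1.symm]

lemma mixed10'
    (h : IsFRT q t)
    (hl : ∀ i j : Fin 4, ∑ k : Fin 4, s i k * t k j = if i = j then 1 else 0)
    (hr : ∀ i j : Fin 4, ∑ k : Fin 4, t i k * s k j = if i = j then 1 else 0)
    (j : Fin 4) (hj : j ≠ 0) :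
    t 1 0 * s j 1 = q • (s j 1 * t 1 0) + (q - q⁻¹) • (s j 0 * t 0 0) := by
  have := mixed h hl hr 1 0 j 1
  simp_all [hj.symm, Fin.sum_univ_four]

lemma MI_stable
    (hq : q ≠ 0)
    (h : IsFRT q t)
    (hl : ∀ i j : Fin 4, ∑ k : Fin 4, s i k * t k j = if i = j then 1 else 0)
    (hr : ∀ i j : Fin 4, ∑ k : Fin 4, t i k * s k j = if i = j then 1 else 0)
    {x : A} (hx : x = t 0 0 ∨ x = t 0 1 ∨ x = t 1 0) {y : A} (hy : y ∈ MI t s) :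
    x * y ∈ MI t s := by
  refine MI_left_of ?_ hy
  intro g hg
  have a02 : t 0 2 ∈ Gset t s := by simp [Gset]
  have a03 : t 0 3 ∈ Gset t s := by simp [Gset]
  have a12 : t 1 2 ∈ Gset t s := by simp [Gset]
  have a13 : t 1 3 ∈ Gset t s := by simp [Gset]
  have a20 : t 2 0 ∈ Gset t s := by simp [Gset]
  have a30 : t 3 0 ∈ Gset t s := by simp [Gset]
  have b20 : s 2 0 ∈ Gset t s := by simp [Gset]
  have b21 : s 2 1 ∈ Gset t s := by simp [Gset]
  have b12 : s 1 2 ∈ Gset t s := by simp [Gset]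
  have b13 : s 1 3 ∈ Gset t s := by simp [Gset]
  simp only [Gset, Set.mem_insert_iff, Set.mem_singleton_iff] at hg
  have c4 : ∀ l, (l = 2 ∨ l = 3) → t 0 l ∈ Gset t s := by rintro l (rfl | rfl) <;> assumption
  have c5 : ∀ l, (l = 2 ∨ l = 3) → t 1 l ∈ Gset t s := by rintro l (rfl | rfl) <;> assumption
  have d1 : ∀ l, (l = 2 ∨ l = 3) → x * t 0 l ∈ MI t s := by
    intro l hl'
    have p0 : (0 : Fin 4) < l := by rcases hl' with rfl | rfl <;> decide
    have p1 : (1 : Fin 4) < l := by rcases hl' with rfl | rfl <;> decide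
    rcases hx with rfl | rfl | rfl
    · exact MI_mem1 q (c4 l hl') (frt_row hq h p0)
    · exact MI_mem1 q (c4 l hl') (frt_row hq h p1)
    · exact MI_mem1 1 (c4 l hl') (by rw [one_smul]; exact (frt_comm h (by decide) p0).symm)
  have d2 : ∀ l, (l = 2 ∨ l = 3) → x * t 1 l ∈ MI t s := by
    intro l hl'
    have p0 : (0 : Fin 4) < l := by rcases hl' with rfl | rfl <;> decide
    have p1 : (1 : Fin 4) < l := by rcases hl' with rfl | rfl <;> decide
    have f0 : t 0 l * t 1 0 = t 1 0 * t 0 l := frt_comm h (by decide) p0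
    have f1 : t 0 l * t 1 1 = t 1 1 * t 0 l := frt_comm h (by decide) p1
    rcases hx with rfl | rfl | rfl
    · exact MI_mem2 1 (q - q⁻¹) (c5 l hl') (c4 l hl')
        (by rw [one_smul, f0]; exact (frt_q h (by decide) p0))
    · exact MI_mem2 1 (q - q⁻¹) (c5 l hl') (c4 l hl')
        (by rw [one_smul, f1]; exact (frt_q h (by decide) p1))
    · exact MI_mem1 q (c5 l hl') (frt_row hq h p0)
  have d3 : ∀ l, (l = 2 ∨ l = 3) → x * t l 0 ∈ MI t s := by
    intro l hl'
    have p0 : (0 : Fin 4) < l := by rcases hl' with rfl | rfl <;> decide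
    have p1 : (1 : Fin 4) < l := by rcases hl' with rfl | rfl <;> decide
    have p2 : t l 0 ∈ Gset t s := by rcases hl' with rfl | rfl <;> assumption
    rcases hx with rfl | rfl | rfl
    · exact MI_mem1 q p2 (frt_col h p0)
    · exact MI_mem1 1 p2 (by rw [one_smul]; exact (frt_comm h p0 (by decide)))
    · exact MI_mem1 q p2 (frt_col h p1)
  have d4 : x * s 2 0 ∈ MI t s := by
    rcases hx with rfl | rfl | rfl
    · exact MI_mem1 _ b20 (mixed00 h hl hr 2 0 (by decide))
    · exact MI_mem1 _ b20 (mixed01 h hl hr 0)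
    · exact MI_mem1 1 b20 (by rw [one_smul]; exact mixed10 h hl hr 2 0 (by decide) (by decide))
  have d5 : x * s 2 1 ∈ MI t s := by
    rcases hx with rfl | rfl | rfl
    · exact MI_mem1 _ b21 (mixed00 h hl hr 2 1 (by decide))
    · exact MI_mem1 _ b21 (mixed01 h hl hr 1)
    · exact MI_mem2 _ _ b21 b20 (mixed10' h hl hr 2 (by decide))
  have d6 : ∀ l, (l = 2 ∨ l = 3) → x * s 1 l ∈ MI t s := by
    intro l hl'
    have p2 : s 1 l ∈ Gset t s := by rcases hl' with rfl | rfl <;> assumption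
    have p1 : l ≠ 1 := by rcases hl' with rfl | rfl <;> decide
    rcases hx with rfl | rfl | rfl
    · exact MI_mem1 _ p2 (mixed00 h hl hr 1 l (by decide))
    · exact MI_mem3 (if l = 0 then 1 else q⁻¹) (-(q⁻¹ * (q - q⁻¹))) (-(q⁻¹ * (q - q⁻¹))) p2 a02 a03
        (by rw [mixed01' hq h hl hr l]; module)
    · exact MI_mem1 1 p2 (by rw [one_smul]; exact mixed10 h hl hr 1 l (by decide) p1)
  rcases hg with rfl | rfl | rfl | rfl | rfl | rfl | rfl | rfl | rfl | rfl
  · exact d1 2 (by simp)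
  · exact d1 3 (by simp)
  · exact d2 2 (by simp)
  · exact d2 3 (by simp)
  · exact d3 2 (by simp)
  · exact d3 3 (by simp)
  · exact d4
  · exact d5
  · exact d6 2 (by simp)
  · exact d6 3 (by simp)

/-- Moving `x ^ n` past `y` modulo a right ideal stable under left multiplication by `x`. -/
lemma pow_pass {M : Submodule ℂ A} (hMr : ∀ y ∈ M, ∀ a, y * a ∈ M) {x y : A}
    (hMl : ∀ y ∈ M, x * y ∈ M) {c : ℂ} (hc : x * y - c • (y * x) ∈ M) (n : ℕ) :
    x ^ n * y - c ^ n • (y * x ^ n) ∈ M := by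
  induction n with
  | zero => simp
  | succ n ih =>
    have e : x ^ (n + 1) * y - c ^ (n + 1) • (y * x ^ (n + 1))
        = x * (x ^ n * y - c ^ n • (y * x ^ n)) + c ^ n • ((x * y - c • (y * x)) * x ^ n) := by
      simp only [pow_succ', mul_sub, sub_mul, mul_smul_comm, smul_mul_assoc, mul_assoc, smul_sub,
        smul_smul]
      module
    rw [e]
    exact M.add_mem (hMl _ ih) (M.smul_mem _ (hMr _ hc _))

lemma pow_stable {M : Submodule ℂ A} {x : A}
    (hMl : ∀ y ∈ M, x * y ∈ M) (n : ℕ) : ∀ y ∈ M, x ^ n * y ∈ M := by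
  induction n with
  | zero => simp
  | succ n ih =>
    intro y hy
    rw [pow_succ', mul_assoc]
    exact hMl _ (ih y hy)

lemma word_stable
    (hq : q ≠ 0)
    (h : IsFRT q t)
    (hl : ∀ i j : Fin 4, ∑ k : Fin 4, s i k * t k j = if i = j then 1 else 0)
    (hr : ∀ i j : Fin 4, ∑ k : Fin 4, t i k * s k j = if i = j then 1 else 0)
    (k m n : ℕ) {y : A} (hy : y ∈ MI t s) :
    t 0 0 ^ k * t 0 1 ^ m * t 1 0 ^ n * y ∈ MI t s := by
  rw [mul_assoc, mul_assoc]
  exact pow_stable (fun y hy => MI_stable hq h hl hr (by simp) hy) k _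
    (pow_stable (fun y hy => MI_stable hq h hl hr (by simp) hy) m _
    (pow_stable (fun y hy => MI_stable hq h hl hr (by simp) hy) n _ hy))

lemma word_pass
    (hq : q ≠ 0)
    (h : IsFRT q t)
    (hl : ∀ i j : Fin 4, ∑ k : Fin 4, s i k * t k j = if i = j then 1 else 0)
    (hr : ∀ i j : Fin 4, ∑ k : Fin 4, t i k * s k j = if i = j then 1 else 0)
    {y : A} {c d e : ℂ} (k m n : ℕ)
    (hc : t 0 0 * y - c • (y * t 0 0) ∈ MI t s)
    (hd : t 0 1 * y - d • (y * t 0 1) ∈ MI t s)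
    (he : t 1 0 * y - e • (y * t 1 0) ∈ MI t s) :
    t 0 0 ^ k * t 0 1 ^ m * t 1 0 ^ n * y
      - (c ^ k * d ^ m * e ^ n) • (y * (t 0 0 ^ k * t 0 1 ^ m * t 1 0 ^ n)) ∈ MI t s := by
  have s0 : ∀ y ∈ MI t s, t 0 0 * y ∈ MI t s := fun y hy => MI_stable hq h hl hr (by simp) hy
  have s1 : ∀ y ∈ MI t s, t 0 1 * y ∈ MI t s := fun y hy => MI_stable hq h hl hr (by simp) hy
  have s2 : ∀ y ∈ MI t s, t 1 0 * y ∈ MI t s := fun y hy => MI_stable hq h hl hr (by simp) hy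
  have r1 := pow_pass (fun y hy a => MI_right hy a) s0 hc k
  have r2 := pow_pass (fun y hy a => MI_right hy a) s1 hd m
  have r3 := pow_pass (fun y hy a => MI_right hy a) s2 he n
  have r3' := pow_stable s0 k _ (pow_stable s1 m _ r3)
  have r2' := MI_right (pow_stable s0 k _ r2) (t 1 0 ^ n)
  have r1' := MI_right r1 (t 0 1 ^ m * t 1 0 ^ n)
  convert (MI t s).add_mem r3' ((MI t s).add_mem ((MI t s).smul_mem (e ^ n) r2')
    ((MI t s).smul_mem (d ^ m * e ^ n) r1')) using 1
  simp only [mul_sub, sub_mul, mul_smul_comm, smul_mul_assoc, mul_assoc, smul_sub, smul_smul]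
  module

/-- Elements of `R` in abstract form. -/
def Rabs (q : ℂ) (t : Fin 4 → Fin 4 → A) : Set A :=
  {t 0 2, t 2 0, t 0 3, t 3 0, t 1 3, t 3 1, t 1 2, t 2 1,
   t 0 0 - t 3 3, t 0 1 + t 3 2, t 1 0 + t 2 3, t 1 1 - t 2 2,
   t 0 0 * t 1 1 - q • (t 0 1 * t 1 0) - 1}

section ideal
variable {I : Submodule ℂ A}

lemma s1_mem
    (hq : q ≠ 0)
    (h : IsFRT q t)
    (hr : ∀ i j : Fin 4, ∑ k : Fin 4, t i k * s k j = if i = j then 1 else 0)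
    (hI : ∀ x ∈ Rabs q t, ∀ a, x * a ∈ I)
    (j : Fin 4) (a : A) :
    (s 1 j - (if j = 1 then t 0 0 else 0) + (if j = 0 then q • t 1 0 else 0)) * a ∈ I := by
  have r0 := hr 0 j
  have r1 := hr 1 j
  rw [Fin.sum_univ_four] at r0 r1
  have i1 := hI (t 0 2) (by simp [Rabs]) (t 1 0 * s 2 j * a)
  have i2 := hI (t 0 3) (by simp [Rabs]) (t 1 0 * s 3 j * a)
  have i3 := hI (t 1 2) (by simp [Rabs]) (t 0 0 * s 2 j * a)
  have i4 := hI (t 1 3) (by simp [Rabs]) (t 0 0 * s 3 j * a)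
  have i5 := hI (t 0 0 * t 1 1 - q • (t 0 1 * t 1 0) - 1) (by simp [Rabs]) (s 1 j * a)
  have c1 : t 0 2 * t 1 0 = t 1 0 * t 0 2 := frt_comm h (by decide) (by decide)
  have c2 : t 0 3 * t 1 0 = t 1 0 * t 0 3 := frt_comm h (by decide) (by decide)
  have c0 : t 0 1 * t 1 0 = t 1 0 * t 0 1 := frt_comm h (by decide) (by decide)
  have c3 : t 0 0 * t 1 2 = _ := frt_q h (by decide) (by decide)
  have c4 : t 0 0 * t 1 3 = _ := frt_q h (by decide) (by decide)
  have c5 : t 0 0 * t 1 0 = q • (t 1 0 * t 0 0) := frt_col h (by decide)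
  have e0 : (if j = 1 then t 0 0 else 0) = t 0 0 * (if 1 = j then (1 : A) else 0) := by
    by_cases hj : j = 1 <;> simp [hj, eq_comm]
  have e1 : (if j = 0 then q • t 1 0 else 0) = q • (t 1 0 * (if 0 = j then (1 : A) else 0)) := by
    by_cases hj : j = 0 <;> simp [hj, eq_comm]
  rw [e0, e1, ← r0, ← r1]
  have key : (s 1 j - t 0 0 * (t 1 0 * s 0 j + t 1 1 * s 1 j + t 1 2 * s 2 j + t 1 3 * s 3 j)
      + q • (t 1 0 * (t 0 0 * s 0 j + t 0 1 * s 1 j + t 0 2 * s 2 j + t 0 3 * s 3 j))) * a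
      = (-1 : ℂ) • ((t 0 0 * t 1 1 - q • (t 0 1 * t 1 0) - 1) * (s 1 j * a))
        + (-1 : ℂ) • (t 1 2 * (t 0 0 * s 2 j * a)) + (-1 : ℂ) • (t 1 3 * (t 0 0 * s 3 j * a))
        + q⁻¹ • (t 0 2 * (t 1 0 * s 2 j * a)) + q⁻¹ • (t 0 3 * (t 1 0 * s 3 j * a)) := by
    have d1 := congrArg (· * (s 2 j * a)) c1
    have d2 := congrArg (· * (s 3 j * a)) c2
    have d0 := congrArg (· * (s 1 j * a)) c0
    have d3 := congrArg (· * (s 2 j * a)) c3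
    have d4 := congrArg (· * (s 3 j * a)) c4
    have d5 := congrArg (· * (s 0 j * a)) c5
    simp only [mul_add, sub_mul, add_mul, smul_mul_assoc, mul_assoc,
      one_mul, smul_add] at *
    linear_combination (norm := module) (-1 : ℂ) • d3 + (-1 : ℂ) • d4 + (-1 : ℂ) • d5
      + (-q) • d0 + (-q⁻¹) • d1 + (-q⁻¹) • d2
  rw [key]
  exact I.add_mem (I.add_mem (I.add_mem (I.add_mem (I.smul_mem _ i5) (I.smul_mem _ i3))
    (I.smul_mem _ i4)) (I.smul_mem _ i1)) (I.smul_mem _ i2)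

lemma s2_aux
    (hq : q ≠ 0)
    (h : IsFRT q t)
    (hr : ∀ i j : Fin 4, ∑ k : Fin 4, t i k * s k j = if i = j then 1 else 0)
    (hI : ∀ x ∈ Rabs q t, ∀ a, x * a ∈ I)
    (j : Fin 4) (a : A) :
    (s 2 j - t 3 3 * (if 2 = j then 1 else 0) + q⁻¹ • (t 2 3 * (if 3 = j then 1 else 0))) * a
      ∈ I := by
  have r2 := hr 2 j
  have r3 := hr 3 j
  rw [Fin.sum_univ_four] at r2 r3
  have i1 := hI (t 2 0) (by simp [Rabs]) (t 3 3 * s 0 j * a)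
  have i2 := hI (t 3 0) (by simp [Rabs]) (t 2 3 * s 0 j * a)
  have i3 := hI (t 2 1) (by simp [Rabs]) (t 3 3 * s 1 j * a)
  have i4 := hI (t 3 1) (by simp [Rabs]) (t 2 3 * s 1 j * a)
  have j1 := hI (t 0 0 - t 3 3) (by simp [Rabs]) (t 2 2 * s 2 j * a)
  have j2 := hI (t 1 1 - t 2 2) (by simp [Rabs]) (t 0 0 * s 2 j * a)
  have j3 := hI (t 2 0) (by simp [Rabs]) (t 0 2 * s 2 j * a)
  have j4 := hI (t 1 0 + t 2 3) (by simp [Rabs]) (t 3 2 * s 2 j * a)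
  have j5 := hI (t 3 0) (by simp [Rabs]) (t 1 2 * s 2 j * a)
  have j6 := hI (t 0 1 + t 3 2) (by simp [Rabs]) (t 1 0 * s 2 j * a)
  have j7 := hI (t 0 0 * t 1 1 - q • (t 0 1 * t 1 0) - 1) (by simp [Rabs]) (s 2 j * a)
  have E1 : t 3 3 * t 2 3 = q⁻¹ • (t 2 3 * t 3 3) := by
    rw [frt_col h (show (2 : Fin 4) < 3 by decide), smul_smul, inv_mul_cancel₀ hq, one_smul]
  have E2 : t 2 0 * t 3 3 = _ := frt_q h (by decide) (by decide)
  have E3 : t 2 3 * t 3 0 = t 3 0 * t 2 3 := frt_comm h (by decide) (by decide)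
  have E2' : t 2 1 * t 3 3 = _ := frt_q h (by decide) (by decide)
  have E3' : t 2 3 * t 3 1 = t 3 1 * t 2 3 := frt_comm h (by decide) (by decide)
  have E4 : t 0 0 * t 2 2 = _ := frt_q h (by decide) (by decide)
  have E5 : t 1 0 * t 3 2 = _ := frt_q h (by decide) (by decide)
  have E6 : t 0 0 * t 1 1 = _ := frt_q h (by decide) (by decide)
  have E7 : t 0 1 * t 1 0 = t 1 0 * t 0 1 := frt_comm h (by decide) (by decide)
  rw [← r2, ← r3]
  have key : (s 2 j - t 3 3 * (t 2 0 * s 0 j + t 2 1 * s 1 j + t 2 2 * s 2 j + t 2 3 * s 3 j)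
      + q⁻¹ • (t 2 3 * (t 3 0 * s 0 j + t 3 1 * s 1 j + t 3 2 * s 2 j + t 3 3 * s 3 j))) * a
      = ((-1 : ℂ) • (t 2 0 * (t 3 3 * s 0 j * a)) + q • (t 3 0 * (t 2 3 * s 0 j * a)))
        + ((-1 : ℂ) • (t 2 1 * (t 3 3 * s 1 j * a)) + q • (t 3 1 * (t 2 3 * s 1 j * a)))
        + ((1 : ℂ) • ((t 0 0 - t 3 3) * (t 2 2 * s 2 j * a))
          + (1 : ℂ) • ((t 1 1 - t 2 2) * (t 0 0 * s 2 j * a)))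
        + ((-(q - q⁻¹)) • (t 2 0 * (t 0 2 * s 2 j * a))
          + q⁻¹ • ((t 1 0 + t 2 3) * (t 3 2 * s 2 j * a)))
        + ((-(q⁻¹ * (q - q⁻¹))) • (t 3 0 * (t 1 2 * s 2 j * a))
          + (-q⁻¹) • ((t 0 1 + t 3 2) * (t 1 0 * s 2 j * a)))
        + (-1 : ℂ) • ((t 0 0 * t 1 1 - q • (t 0 1 * t 1 0) - 1) * (s 2 j * a)) := by
    have d1 := congrArg (· * (s 3 j * a)) E1
    have d2 := congrArg (· * (s 0 j * a)) E2
    have d3 := congrArg (· * (s 0 j * a)) E3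
    have d2' := congrArg (· * (s 1 j * a)) E2'
    have d3' := congrArg (· * (s 1 j * a)) E3'
    have d4 := congrArg (· * (s 2 j * a)) E4
    have d5 := congrArg (· * (s 2 j * a)) E5
    have d6 := congrArg (· * (s 2 j * a)) E6
    have d7 := congrArg (· * (s 2 j * a)) E7
    clear E1 E2 E3 E2' E3' E4 E5 E6 E7 i1 i2 i3 i4 j1 j2 j3 j4 j5 j6 j7 r2 r3
    simp only [mul_add, sub_mul, add_mul, smul_mul_assoc, mul_assoc,
      one_mul, smul_add] at *
    linear_combination (norm := module) (-1 : ℂ) • d1 + (1 : ℂ) • d2 + q⁻¹ • d3 + (1 : ℂ) • d2' + q⁻¹ • d3'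
      + (-1 : ℂ) • d4 + (-q⁻¹) • d5 + (1 : ℂ) • d6 + (-(q - q⁻¹)) • d7
  rw [key]
  have A2 : ∀ {u v : A} (c d : ℂ), u ∈ I → v ∈ I → c • u + d • v ∈ I := fun c d hu hv =>
    I.add_mem (I.smul_mem _ hu) (I.smul_mem _ hv)
  exact I.add_mem (I.add_mem (I.add_mem (I.add_mem (I.add_mem (A2 _ _ i1 i2) (A2 _ _ i3 i4))
    (A2 _ _ j1 j2)) (A2 _ _ j3 j4)) (A2 _ _ j5 j6)) (I.smul_mem _ j7)

lemma s2_mem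
    (hq : q ≠ 0)
    (h : IsFRT q t)
    (hr : ∀ i j : Fin 4, ∑ k : Fin 4, t i k * s k j = if i = j then 1 else 0)
    (hI : ∀ x ∈ Rabs q t, ∀ a, x * a ∈ I)
    (j : Fin 4) (a : A) :
    (s 2 j - (if j = 2 then t 0 0 else 0) - (if j = 3 then q⁻¹ • t 1 0 else 0)) * a ∈ I := by
  have k0 := s2_aux hq h hr hI j a
  have k1 := hI (t 0 0 - t 3 3) (by simp [Rabs]) ((if 2 = j then 1 else 0) * a)
  have k2 := hI (t 1 0 + t 2 3) (by simp [Rabs]) ((if 3 = j then 1 else 0) * a)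
  convert I.add_mem k0 (I.add_mem (I.smul_mem (-1 : ℂ) k1) (I.smul_mem (-q⁻¹) k2)) using 1
  have e0 : (if j = 2 then t 0 0 else 0) = t 0 0 * (if 2 = j then (1 : A) else 0) := by
    by_cases hj : j = 2 <;> simp [hj, eq_comm]
  have e1 : (if j = 3 then q⁻¹ • t 1 0 else 0) = q⁻¹ • (t 1 0 * (if 3 = j then (1 : A) else 0)) := by
    by_cases hj : j = 3 <;> simp [hj, eq_comm]
  rw [e0, e1]
  simp only [sub_mul, add_mul, smul_mul_assoc, mul_assoc, smul_add]
  module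

lemma MI_le_I
    (hq : q ≠ 0)
    (h : IsFRT q t)
    (hr : ∀ i j : Fin 4, ∑ k : Fin 4, t i k * s k j = if i = j then 1 else 0)
    (hI : ∀ x ∈ Rabs q t, ∀ a, x * a ∈ I)
    : MI t s ≤ I := by
  refine MI_le ?_
  intro g hg a
  simp only [Gset, Set.mem_insert_iff, Set.mem_singleton_iff] at hg
  rcases hg with rfl | rfl | rfl | rfl | rfl | rfl | rfl | rfl | rfl | rfl
  · exact hI _ (by simp [Rabs]) a
  · exact hI _ (by simp [Rabs]) a
  · exact hI _ (by simp [Rabs]) a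
  · exact hI _ (by simp [Rabs]) a
  · exact hI _ (by simp [Rabs]) a
  · exact hI _ (by simp [Rabs]) a
  · simpa using s2_mem hq h hr hI 0 a
  · simpa using s2_mem hq h hr hI 1 a
  · simpa using s1_mem hq h hr hI 2 a
  · simpa using s1_mem hq h hr hI 3 a

variable {C : Type*} [AddCommGroup C] [Module ℂ C] (r : A →ₗ[ℂ] C)

lemma r_zero
    (hq : q ≠ 0)
    (h : IsFRT q t)
    (hl : ∀ i j : Fin 4, ∑ k : Fin 4, s i k * t k j = if i = j then 1 else 0)
    (hr : ∀ i j : Fin 4, ∑ k : Fin 4, t i k * s k j = if i = j then 1 else 0)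
    (hI : ∀ x ∈ Rabs q t, ∀ a, x * a ∈ I)
    (r : A →ₗ[ℂ] C) (hrI : ∀ y ∈ I, r y = 0)
    (k m n : ℕ) {g : A} (hg : g ∈ Gset t s) :
    r (t 0 0 ^ k * t 0 1 ^ m * t 1 0 ^ n * g) = 0 := by
  refine hrI _ (MI_le_I hq h hr hI (word_stable hq h hl hr k m n ?_))
  simpa using MI_gen hg 1

lemma r_pass
    (hq : q ≠ 0)
    (h : IsFRT q t)
    (hl : ∀ i j : Fin 4, ∑ k : Fin 4, s i k * t k j = if i = j then 1 else 0)
    (hr : ∀ i j : Fin 4, ∑ k : Fin 4, t i k * s k j = if i = j then 1 else 0)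
    (hI : ∀ x ∈ Rabs q t, ∀ a, x * a ∈ I)
    (r : A →ₗ[ℂ] C) (hrI : ∀ y ∈ I, r y = 0)
    {y : A} {c d e : ℂ} (k m n : ℕ)
    (hc : t 0 0 * y - c • (y * t 0 0) ∈ MI t s)
    (hd : t 0 1 * y - d • (y * t 0 1) ∈ MI t s)
    (he : t 1 0 * y - e • (y * t 1 0) ∈ MI t s) :
    r (t 0 0 ^ k * t 0 1 ^ m * t 1 0 ^ n * y)
      = (c ^ k * d ^ m * e ^ n) • r (y * (t 0 0 ^ k * t 0 1 ^ m * t 1 0 ^ n)) := by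
  have := hrI _ (MI_le_I hq h hr hI (word_pass hq h hl hr k m n hc hd he))
  rwa [map_sub, map_smul, sub_eq_zero] at this

lemma r_t00
    (hq : q ≠ 0)
    (h : IsFRT q t)
    (hl : ∀ i j : Fin 4, ∑ k : Fin 4, s i k * t k j = if i = j then 1 else 0)
    (hr : ∀ i j : Fin 4, ∑ k : Fin 4, t i k * s k j = if i = j then 1 else 0)
    (hI : ∀ x ∈ Rabs q t, ∀ a, x * a ∈ I)
    (r : A →ₗ[ℂ] C) (hrI : ∀ y ∈ I, r y = 0)
    (k m n : ℕ) : r (t 0 0 ^ k * t 0 1 ^ m * t 1 0 ^ n * t 0 0)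
      = (q⁻¹ ^ m * q⁻¹ ^ n) • r (t 0 0 * (t 0 0 ^ k * t 0 1 ^ m * t 1 0 ^ n)) := by
  have e1 : t 0 0 * t 0 1 = q • (t 0 1 * t 0 0) := frt_row hq h (by decide)
  have e2 : t 0 0 * t 1 0 = q • (t 1 0 * t 0 0) := frt_col h (by decide)
  rw [r_pass (c := 1) (d := q⁻¹) (e := q⁻¹) hq h hl hr hI r hrI k m n]
  · simp
  · simp
  · rw [e1, smul_smul, inv_mul_cancel₀ hq]; simp
  · rw [e2, smul_smul, inv_mul_cancel₀ hq]; simp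

lemma r_t10
    (hq : q ≠ 0)
    (h : IsFRT q t)
    (hl : ∀ i j : Fin 4, ∑ k : Fin 4, s i k * t k j = if i = j then 1 else 0)
    (hr : ∀ i j : Fin 4, ∑ k : Fin 4, t i k * s k j = if i = j then 1 else 0)
    (hI : ∀ x ∈ Rabs q t, ∀ a, x * a ∈ I)
    (r : A →ₗ[ℂ] C) (hrI : ∀ y ∈ I, r y = 0)
    (k m n : ℕ) : r (t 0 0 ^ k * t 0 1 ^ m * t 1 0 ^ n * t 1 0)
      = q ^ k • r (t 1 0 * (t 0 0 ^ k * t 0 1 ^ m * t 1 0 ^ n)) := by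
  have e1 : t 0 1 * t 1 0 = t 1 0 * t 0 1 := frt_comm h (by decide) (by decide)
  have e2 : t 0 0 * t 1 0 = q • (t 1 0 * t 0 0) := frt_col h (by decide)
  rw [r_pass (c := q) (d := 1) (e := 1) hq h hl hr hI r hrI k m n]
  · simp
  · simp [e2]
  · simp [e1]
  · simp

lemma r_tl3
    (hq : q ≠ 0)
    (h : IsFRT q t)
    (hl : ∀ i j : Fin 4, ∑ k : Fin 4, s i k * t k j = if i = j then 1 else 0)
    (hr : ∀ i j : Fin 4, ∑ k : Fin 4, t i k * s k j = if i = j then 1 else 0)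
    (hI : ∀ x ∈ Rabs q t, ∀ a, x * a ∈ I)
    (r : A →ₗ[ℂ] C) (hrI : ∀ y ∈ I, r y = 0)
    (k m n : ℕ) (l : Fin 4) (hl' : l = 2 ∨ l = 3) :
    r (t 0 0 ^ k * t 0 1 ^ m * t 1 0 ^ n * t l 3)
      = r (t l 3 * (t 0 0 ^ k * t 0 1 ^ m * t 1 0 ^ n)) := by
  have p0 : (0 : Fin 4) < l := by rcases hl' with rfl | rfl <;> decide
  have p1 : (1 : Fin 4) < l := by rcases hl' with rfl | rfl <;> decide
  have f0 : t 0 3 * t l 0 = t l 0 * t 0 3 := frt_comm h p0 (by decide)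
  have f1 : t 0 3 * t l 1 = t l 1 * t 0 3 := frt_comm h p0 (by decide)
  have f2 : t 1 3 * t l 0 = t l 0 * t 1 3 := frt_comm h p1 (by decide)
  have g0 : t 0 0 * t l 3 = _ := frt_q h p0 (by decide)
  have g1 : t 0 1 * t l 3 = _ := frt_q h p0 (by decide)
  have g2 : t 1 0 * t l 3 = _ := frt_q h p1 (by decide)
  have a03 : t 0 3 ∈ Gset t s := by simp [Gset]
  have a13 : t 1 3 ∈ Gset t s := by simp [Gset]
  rw [r_pass (c := 1) (d := 1) (e := 1) hq h hl hr hI r hrI k m n]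
  · simp
  · exact MI_mem1 (q - q⁻¹) a03 (by rw [g0, f0, one_smul]; abel)
  · exact MI_mem1 (q - q⁻¹) a03 (by rw [g1, f1, one_smul]; abel)
  · exact MI_mem1 (q - q⁻¹) a13 (by rw [g2, f2, one_smul]; abel)

lemma r_s2
    (hq : q ≠ 0)
    (h : IsFRT q t)
    (hl : ∀ i j : Fin 4, ∑ k : Fin 4, s i k * t k j = if i = j then 1 else 0)
    (hr : ∀ i j : Fin 4, ∑ k : Fin 4, t i k * s k j = if i = j then 1 else 0)
    (hI : ∀ x ∈ Rabs q t, ∀ a, x * a ∈ I)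
    (r : A →ₗ[ℂ] C) (hrI : ∀ y ∈ I, r y = 0)
    (k m n : ℕ) (l : Fin 4) (hl' : l = 2 ∨ l = 3) :
    r (t 0 0 ^ k * t 0 1 ^ m * t 1 0 ^ n * s 2 l)
      = r (s 2 l * (t 0 0 ^ k * t 0 1 ^ m * t 1 0 ^ n)) := by
  have p0 : l ≠ 0 := by rcases hl' with rfl | rfl <;> decide
  have p1 : l ≠ 1 := by rcases hl' with rfl | rfl <;> decide
  rw [r_pass (c := 1) (d := 1) (e := 1) hq h hl hr hI r hrI k m n]
  · simp
  · rw [mixed00 h hl hr 2 l (by decide)]; simp [p0]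
  · rw [mixed01 h hl hr l]; simp [p0]
  · rw [mixed10 h hl hr 2 l (by decide) p1]; simp

lemma r_s10
    (hq : q ≠ 0)
    (h : IsFRT q t)
    (hl : ∀ i j : Fin 4, ∑ k : Fin 4, s i k * t k j = if i = j then 1 else 0)
    (hr : ∀ i j : Fin 4, ∑ k : Fin 4, t i k * s k j = if i = j then 1 else 0)
    (hI : ∀ x ∈ Rabs q t, ∀ a, x * a ∈ I)
    (r : A →ₗ[ℂ] C) (hrI : ∀ y ∈ I, r y = 0)
    (k m n : ℕ) :
    r (t 0 0 ^ k * t 0 1 ^ m * t 1 0 ^ n * s 1 0)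
      = q ^ k • r (s 1 0 * (t 0 0 ^ k * t 0 1 ^ m * t 1 0 ^ n)) := by
  have a02 : t 0 2 ∈ Gset t s := by simp [Gset]
  have a03 : t 0 3 ∈ Gset t s := by simp [Gset]
  rw [r_pass (c := q) (d := 1) (e := 1) hq h hl hr hI r hrI k m n]
  · simp
  · rw [mixed00 h hl hr 1 0 (by decide)]; simp
  · refine MI_mem2 (-(q⁻¹ * (q - q⁻¹))) (-(q⁻¹ * (q - q⁻¹))) a02 a03 (a := s 2 0) (a' := s 3 0) ?_
    rw [mixed01' hq h hl hr 0, if_pos rfl]; module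
  · rw [mixed10 h hl hr 1 0 (by decide) (by decide)]; simp

lemma r_s11
    (hq : q ≠ 0)
    (h : IsFRT q t)
    (hl : ∀ i j : Fin 4, ∑ k : Fin 4, s i k * t k j = if i = j then 1 else 0)
    (hr : ∀ i j : Fin 4, ∑ k : Fin 4, t i k * s k j = if i = j then 1 else 0)
    (hI : ∀ x ∈ Rabs q t, ∀ a, x * a ∈ I)
    (r : A →ₗ[ℂ] C) (hrI : ∀ y ∈ I, r y = 0)
    (k m n : ℕ) :
    r (t 0 0 ^ k * t 0 1 ^ m * t 1 0 ^ n * s 1 1)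
      = (q⁻¹ ^ m * q⁻¹ ^ n) • r (s 1 1 * (t 0 0 ^ k * t 0 1 ^ m * t 1 0 ^ n)) := by
  have a02 : t 0 2 ∈ Gset t s := by simp [Gset]
  have a03 : t 0 3 ∈ Gset t s := by simp [Gset]
  have b12 : s 1 2 ∈ Gset t s := by simp [Gset]
  have b13 : s 1 3 ∈ Gset t s := by simp [Gset]
  rw [r_pass (c := 1) (d := q⁻¹) (e := q⁻¹) hq h hl hr hI r hrI k m n]
  · simp
  · rw [mixed00 h hl hr 1 1 (by decide)]; simp
  · refine MI_mem2 (-(q⁻¹ * (q - q⁻¹))) (-(q⁻¹ * (q - q⁻¹))) a02 a03 (a := s 2 1) (a' := s 3 1) ?_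
    rw [mixed01' hq h hl hr 1, if_neg (by decide)]; module
  · refine MI_mem2 (-(q - q⁻¹)) (-(q - q⁻¹)) b12 b13 (a := t 2 0) (a' := t 3 0) ?_
    have e := hl 1 0
    rw [Fin.sum_univ_four, if_neg (by decide)] at e
    rw [mixed10' h hl hr 1 (by decide)]
    linear_combination (norm := module) (q - q⁻¹) • e

/-- All the values needed, collected. -/
lemma r_values (k m n : ℕ) (b : A) (hb : b = t 0 0 ^ k * t 0 1 ^ m * t 1 0 ^ n)
    (hq : q ≠ 0) (h : IsFRT q t)
    (hl : ∀ i j : Fin 4, ∑ k : Fin 4, s i k * t k j = if i = j then 1 else 0)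
    (hr : ∀ i j : Fin 4, ∑ k : Fin 4, t i k * s k j = if i = j then 1 else 0)
    (hI : ∀ x ∈ Rabs q t, ∀ a, x * a ∈ I) (hrI : ∀ y ∈ I, r y = 0) :
    (r (b * t 0 0) = (q⁻¹ ^ m * q⁻¹ ^ n) • r (t 0 0 * b) ∧ r (b * t 1 0) = q ^ k • r (t 1 0 * b)
      ∧ r (b * t 2 0) = 0 ∧ r (b * t 3 0) = 0) ∧
    (r (b * s 1 0) = (-q ^ k * q) • r (t 1 0 * b)
      ∧ r (b * s 1 1) = (q⁻¹ ^ m * q⁻¹ ^ n) • r (t 0 0 * b)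
      ∧ r (b * s 1 2) = 0 ∧ r (b * s 1 3) = 0) ∧
    (r (b * s 2 0) = 0 ∧ r (b * s 2 1) = 0
      ∧ r (b * s 2 2) = r (t 0 0 * b) ∧ r (b * s 2 3) = q⁻¹ • r (t 1 0 * b)) ∧
    (r (b * t 0 3) = 0 ∧ r (b * t 1 3) = 0
      ∧ r (b * t 2 3) = - r (t 1 0 * b) ∧ r (b * t 3 3) = r (t 0 0 * b)) := by
  have z0 := fun {g : A} => r_zero (g := g) hq h hl hr hI r hrI k m n
  have v10 := hrI _ (s1_mem hq h hr hI 0 b)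
  have v11 := hrI _ (s1_mem hq h hr hI 1 b)
  have v22 := hrI _ (s2_mem hq h hr hI 2 b)
  have v23 := hrI _ (s2_mem hq h hr hI 3 b)
  have w23 := hrI _ (hI (t 1 0 + t 2 3) (by simp [Rabs]) b)
  have w33 := hrI _ (hI (t 0 0 - t 3 3) (by simp [Rabs]) b)
  have u00 := r_t00 hq h hl hr hI r hrI k m n
  have u10 := r_t10 hq h hl hr hI r hrI k m n
  have u23 := r_tl3 hq h hl hr hI r hrI k m n 2 (by simp)
  have u33 := r_tl3 hq h hl hr hI r hrI k m n 3 (by simp)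
  have x22 := r_s2 hq h hl hr hI r hrI k m n 2 (by simp)
  have x23 := r_s2 hq h hl hr hI r hrI k m n 3 (by simp)
  have x10 := r_s10 hq h hl hr hI r hrI k m n
  have x11 := r_s11 hq h hl hr hI r hrI k m n
  rw [← hb] at u00 u10 u23 u33 x22 x23 x10 x11
  simp only [← hb] at z0
  simp [add_mul, sub_mul] at v10 v11 v22 v23 w23 w33
  refine ⟨⟨u00, u10, z0 (by simp [Gset]), z0 (by simp [Gset])⟩,
    ⟨?_, ?_, z0 (by simp [Gset]), z0 (by simp [Gset])⟩,
    ⟨z0 (by simp [Gset]), z0 (by simp [Gset]), ?_, ?_⟩,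
    ⟨z0 (by simp [Gset]), z0 (by simp [Gset]), ?_, ?_⟩⟩
  · rw [x10]; linear_combination (norm := module) q ^ k • v10
  · rw [x11]; linear_combination (norm := module) (q⁻¹ ^ m * q⁻¹ ^ n) • v11
  · rw [x22]; linear_combination (norm := module) (1 : ℂ) • v22
  · rw [x23]; linear_combination (norm := module) (1 : ℂ) • v23
  · rw [u23]; linear_combination (norm := module) (1 : ℂ) • w23
  · rw [u33]; linear_combination (norm := module) (-1 : ℂ) • w33

end ideal

end Abstract

lemma isFRT_tt (q : ℝ) (hq : (q : ℂ) ≠ 0) : IsFRT (q : ℂ) (tt q) := by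
  have col : ∀ {i j k : Fin 4}, i < j → tt q i k * tt q j k = (q : ℂ) • (tt q j k * tt q i k) := by
    intro i j k hij
    have := RingQuot.mkAlgHom_rel ℂ (relU.col (q := q) (k := k) hij)
    simpa only [tt, map_mul, map_smul] using this
  have row : ∀ {i j k : Fin 4}, i < j → tt q k i * tt q k j = (q : ℂ) • (tt q k j * tt q k i) := by
    intro i j k hij
    have := RingQuot.mkAlgHom_rel ℂ (relU.row (q := q) (k := k) hij)
    simpa only [tt, map_mul, map_smul] using this
  have comm : ∀ {i j k l : Fin 4}, i < j → k < l → tt q i l * tt q j k = tt q j k * tt q i l := by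
    intro i j k l hij hkl
    have := RingQuot.mkAlgHom_rel ℂ (relU.comm (q := q) hij hkl)
    simpa only [tt, map_mul, map_smul] using this
  have qcom : ∀ {i j k l : Fin 4}, i < j → k < l → tt q i k * tt q j l - tt q j l * tt q i k
      = ((q : ℂ) - (q : ℂ)⁻¹) • (tt q j k * tt q i l) := by
    intro i j k l hij hkl
    have := RingQuot.mkAlgHom_rel ℂ (relU.qcom (q := q) hij hkl)
    simpa only [tt, map_mul, map_smul, map_sub] using this
  intro i j k l
  rcases lt_trichotomy i j with hij | rfl | hij <;> rcases lt_trichotomy k l with hkl | rfl | hkl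
  · simp only [hij.ne, hij.not_gt, hkl, hkl.ne, if_true, if_false]
    linear_combination (norm := module) (1 : ℂ) • qcom hij hkl
  · simp only [hij.ne, hij.not_gt, lt_irrefl, if_true, if_false]
    linear_combination (norm := module) (1 : ℂ) • col (k := k) hij
  · simp only [hij.ne, hij.not_gt, hkl.ne', hkl.not_gt, if_true, if_false]
    linear_combination (norm := module) (1 : ℂ) • comm hij hkl
  · simp only [hkl, hkl.ne, lt_irrefl, if_true, if_false]
    have e := row (k := i) hkl
    have e' : tt q i l * tt q i k = (q : ℂ)⁻¹ • (tt q i k * tt q i l) := by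
      rw [e, smul_smul, inv_mul_cancel₀ hq, one_smul]
    rw [e']; module
  · simp
  · simp only [hkl.ne', hkl.not_gt, lt_irrefl, if_true, if_false]
    linear_combination (norm := module) (-1 : ℂ) • row (k := i) hkl
  · simp only [hij.ne', hij, hkl, hkl.ne, if_true, if_false]
    linear_combination (norm := module) (-1 : ℂ) • comm hij hkl
  · simp only [hij.ne', hij, lt_irrefl, if_true, if_false]
    have e := col (k := k) hij
    have e' : tt q i k * tt q j k = (q : ℂ)⁻¹ • (tt q j k * tt q i k) := by
      rw [e, smul_smul, inv_mul_cancel₀ hq, one_smul]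
    rw [e']; module
  · simp only [hij.ne', hij, hkl.ne', hkl.not_gt, if_true, if_false]
    linear_combination (norm := module) (-1 : ℂ) • qcom hij hkl
      + ((q : ℂ) - (q : ℂ)⁻¹) • comm hij hkl

lemma chi_lact (q : ℝ) (δ : PA q →ₐ[ℂ] PA q ⊗[ℂ] AU q)
    (chi : PBP q δ →ₗ[ℂ] PA q ⊗[ℂ] Cq q)
    (hchi : ∀ p' p : PA q, chi (mkT q δ (p' ⊗ₜ[ℂ] p)) =
      TensorProduct.map (LinearMap.mulLeft ℂ p') LinearMap.id (Dr q δ p))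
    (p : PA q) (x : PBP q δ) :
    chi (lact q δ p x) = TensorProduct.map (LinearMap.mulLeft ℂ p) LinearMap.id (chi x) := by
  obtain ⟨y, rfl⟩ := Submodule.mkQ_surjective _ x
  change chi (mkT q δ (TensorProduct.map (LinearMap.mulLeft ℂ p) LinearMap.id y)) =
    TensorProduct.map (LinearMap.mulLeft ℂ p) LinearMap.id (chi (mkT q δ y))
  induction y using TensorProduct.induction_on with
  | zero => simp only [map_zero]
  | add u v hu hv => simp only [map_add, hu, hv]
  | tmul u v =>
    rw [TensorProduct.map_tmul, LinearMap.id_apply, LinearMap.mulLeft_apply, hchi, hchi,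
      LinearMap.mulLeft_mul]
    generalize Dr q δ v = w
    induction w using TensorProduct.induction_on with
    | zero => simp only [map_zero]
    | add u v hu hv => simp only [map_add, hu, hv]
    | tmul v0 v1 => simp only [TensorProduct.map_tmul, LinearMap.comp_apply, LinearMap.id_apply]

lemma chi_ract (q : ℝ) (δ : PA q →ₐ[ℂ] PA q ⊗[ℂ] AU q)
    (chi : PBP q δ →ₗ[ℂ] PA q ⊗[ℂ] Cq q)
    (hchi : ∀ p' p : PA q, chi (mkT q δ (p' ⊗ₜ[ℂ] p)) =
      TensorProduct.map (LinearMap.mulLeft ℂ p') LinearMap.id (Dr q δ p))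
    (p : PA q) (u : Fin 4 → PA q) (a : Fin 4 → AU q) (hp : δ p = ∑ j : Fin 4, u j ⊗ₜ[ℂ] a j)
    (x : PBP q δ) :
    chi (ract q δ p x) = ∑ j : Fin 4,
      TensorProduct.map (LinearMap.mulRight ℂ (u j)) (cact q (a j)) (chi x) := by
  obtain ⟨y, rfl⟩ := Submodule.mkQ_surjective _ x
  change chi (mkT q δ (TensorProduct.map LinearMap.id (LinearMap.mulRight ℂ p) y)) =
    ∑ j : Fin 4, TensorProduct.map (LinearMap.mulRight ℂ (u j)) (cact q (a j)) (chi (mkT q δ y))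
  induction y using TensorProduct.induction_on with
  | zero => simp only [map_zero, Finset.sum_const_zero]
  | add u v hu hv => simp only [map_add, hu, hv, Finset.sum_add_distrib]
  | tmul p' v =>
    rw [TensorProduct.map_tmul, LinearMap.id_apply, LinearMap.mulRight_apply, hchi, hchi]
    simp only [Dr, LinearMap.comp_apply, AlgHom.toLinearMap_apply, map_mul, hp]
    generalize δ v = w
    induction w using TensorProduct.induction_on with
    | zero => simp only [map_zero, Finset.sum_const_zero, zero_mul]
    | add u v hu hv => simp only [map_add, hu, hv, Finset.sum_add_distrib, add_mul]
    | tmul v0 v1 =>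
      simp only [Finset.mul_sum, map_sum, Algebra.TensorProduct.tmul_mul_tmul,
        LinearMap.lTensor_tmul, TensorProduct.map_tmul, LinearMap.id_apply,
        LinearMap.mulLeft_apply, LinearMap.mulRight_apply, cact_mk, mul_assoc]

lemma chi_step (q : ℝ) (δ : PA q →ₐ[ℂ] PA q ⊗[ℂ] AU q)
    (chi : PBP q δ →ₗ[ℂ] PA q ⊗[ℂ] Cq q)
    (hchi : ∀ p' p : PA q, chi (mkT q δ (p' ⊗ₜ[ℂ] p)) =
      TensorProduct.map (LinearMap.mulLeft ℂ p') LinearMap.id (Dr q δ p))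
    (p' p : PA q) (u : Fin 4 → PA q) (a : Fin 4 → AU q) (hp : δ p = ∑ j : Fin 4, u j ⊗ₜ[ℂ] a j)
    (x : PBP q δ) (b : AU q) (hx : chi x = 1 ⊗ₜ[ℂ] rr q b) :
    chi (lact q δ p' (ract q δ p x)) = (p' * u 0) ⊗ₜ[ℂ] rr q (b * a 0)
      + (p' * u 1) ⊗ₜ[ℂ] rr q (b * a 1) + (p' * u 2) ⊗ₜ[ℂ] rr q (b * a 2)
      + (p' * u 3) ⊗ₜ[ℂ] rr q (b * a 3) := by
  rw [chi_lact q δ chi hchi, chi_ract q δ chi hchi p u a hp, hx, Fin.sum_univ_four]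
  simp only [map_add, TensorProduct.map_tmul, LinearMap.id_apply,
        LinearMap.mulLeft_apply, LinearMap.mulRight_apply, cact_mk, one_mul]

lemma sphere_sz (q : ℝ) {i j : Fin 4} (hij : i ≠ j) :
    zs q j * z q i = (q : ℂ) • (z q i * zs q j) := by
  have := RingQuot.mkAlgHom_rel ℂ (relS.sz (q := q) hij)
  simpa only [z, zs, map_mul, map_smul] using this

lemma sphere_szz0 (q : ℝ) : zs q 0 * z q 0 = z q 0 * zs q 0 := by
  have := RingQuot.mkAlgHom_rel ℂ (relS.szz (q := q) (k := 0))
  rw [Finset.filter_false_of_mem (by simp), Finset.sum_empty, smul_zero, add_zero] at this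
  simpa only [z, zs, map_mul] using this

lemma sphere_szz3 (q : ℝ) : zs q 3 * z q 3 = z q 3 * zs q 3
    + (1 - (q : ℂ) ^ 2) • (z q 0 * zs q 0 + z q 1 * zs q 1 + z q 2 * zs q 2) := by
  have := RingQuot.mkAlgHom_rel ℂ (relS.szz (q := q) (k := 3))
  have e : (Finset.univ.filter (· < (3 : Fin 4))) = {0, 1, 2} := by decide
  rw [e, Finset.sum_insert (by decide), Finset.sum_insert (by decide), Finset.sum_singleton,
    ← add_assoc] at this
  simpa only [z, zs, map_mul, map_add, map_smul] using this

lemma sphere_sum (q : ℝ) :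
    z q 0 * zs q 0 + z q 1 * zs q 1 + z q 2 * zs q 2 + z q 3 * zs q 3 = 1 := by
  have := RingQuot.mkAlgHom_rel ℂ (relS.sum1 (q := q))
  rw [Fin.sum_univ_four] at this
  simpa only [z, zs, map_mul, map_add, map_one] using this

theorem tau_step_k_up (q : ℝ) (hq0 : 0 < q) (hq1 : q < 1)
    [StarRing (AU q)] [StarModule ℂ (AU q)]
    (S : AU q →ₗ[ℂ] AU q)
    (hSanti : ∀ x y : AU q, S (x * y) = S y * S x) (hS1 : S 1 = 1)
    (hSleft : ∀ i j : Fin 4, ∑ k : Fin 4, S (tt q i k) * tt q k j = if i = j then 1 else 0)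
    (hSright : ∀ i j : Fin 4, ∑ k : Fin 4, tt q i k * S (tt q k j) = if i = j then 1 else 0)
    (hSD : S (Dq q) = dI q) (hSDi : S (dI q) = Dq q)
    (hstarT : ∀ i j : Fin 4, star (tt q i j) = S (tt q j i))
    (hstarD : star (Dq q) = dI q)
    [StarRing (PA q)] [StarModule ℂ (PA q)]
    (hstarz : ∀ i : Fin 4, star (z q i) = zs q i)
    (δ : PA q →ₐ[ℂ] PA q ⊗[ℂ] AU q)
    (hδz : ∀ i : Fin 4, δ (z q i) = ∑ j : Fin 4, z q j ⊗ₜ[ℂ] tt q j i)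
    (hδzs : ∀ i : Fin 4, δ (zs q i) = ∑ j : Fin 4, zs q j ⊗ₜ[ℂ] star (tt q j i))
    (chi : PBP q δ →ₗ[ℂ] PA q ⊗[ℂ] Cq q)
    (hchi : ∀ p' p : PA q, chi (mkT q δ (p' ⊗ₜ[ℂ] p)) =
      TensorProduct.map (LinearMap.mulLeft ℂ p') LinearMap.id (Dr q δ p))
    (k : ℤ) (hk : 0 ≤ k) (m n : ℕ) (x : PBP q δ)
    (hx : chi x = 1 ⊗ₜ[ℂ] rr q (bas q k m n))
        : chi (((q : ℂ) ^ (2 + m + n)) • lact q δ (star (z q 0)) (ract q δ (z q 0) x)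
        + ((q : ℂ) ^ (2 + m + n)) • lact q δ (z q 1) (ract q δ (star (z q 1)) x)
        + ((q : ℂ) ^ 2) • lact q δ (z q 2) (ract q δ (star (z q 2)) x)
        + lact q δ (star (z q 3)) (ract q δ (z q 3) x))
      = 1 ⊗ₜ[ℂ] rr q (bas q (k + 1) m n) := by
  have hq : (q : ℂ) ≠ 0 := by exact_mod_cast hq0.ne'
  simp only [hstarz]
  simp only [map_add, map_smul]
  rw [chi_step q δ chi hchi (zs q 0) (z q 0) (z q) (fun j => tt q j 0) (hδz 0) x _ hx,
    chi_step q δ chi hchi (z q 1) (zs q 1) (zs q) (fun j => S (tt q 1 j))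
      (by simp only [hδzs, hstarT]) x _ hx,
    chi_step q δ chi hchi (z q 2) (zs q 2) (zs q) (fun j => S (tt q 2 j))
      (by simp only [hδzs, hstarT]) x _ hx,
    chi_step q δ chi hchi (zs q 3) (z q 3) (z q) (fun j => tt q j 3) (hδz 3) x _ hx]
  obtain ⟨K, rfl⟩ := Int.eq_ofNat_of_zero_le hk
  have hb : bas q (K : ℤ) m n = tt q 0 0 ^ K * tt q 0 1 ^ m * tt q 1 0 ^ n := by
    simp [bas]
  have hb' : bas q ((K : ℤ) + 1) m n = tt q 0 0 * bas q (K : ℤ) m n := by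
    have e : ((K : ℤ) + 1).toNat = K + 1 := by omega
    rw [hb, bas, if_pos (by omega), e, pow_succ']
    simp only [mul_assoc]
  rw [hb']
  obtain ⟨⟨a0, a1, a2, a3⟩, ⟨b0, b1, b2, b3⟩, ⟨c0, c1, c2, c3⟩, ⟨d0, d1, d2, d3⟩⟩ :=
    r_values (t := tt q) (s := fun i j => S (tt q i j)) (I := RIdeal q) (rr q) K m n
      (bas q (K : ℤ) m n) hb hq (isFRT_tt q hq) hSleft hSright
      (fun x hx a => Submodule.subset_span ⟨x, hx, a, rfl⟩)
      (fun y hy => by simpa [rr] using hy)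
  simp only [a0, a1, a2, a3, b0, b1, b2, b3, c0, c1, c2, c3, d0, d1, d2, d3]
  generalize rr q (tt q 0 0 * bas q (K : ℤ) m n) = ρ
  generalize rr q (tt q 1 0 * bas q (K : ℤ) m n) = ρ'
  rw [sphere_sz q (i := 1) (j := 0) (by decide), sphere_sz q (i := 2) (j := 3) (by decide),
    sphere_szz0, sphere_szz3, ← sphere_sum q]
  have hp : (q : ℂ) ^ (2 + m + n) * ((q : ℂ)⁻¹ ^ m * (q : ℂ)⁻¹ ^ n) = (q : ℂ) ^ 2 := by
    rw [pow_add, pow_add, inv_pow, inv_pow]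
    field_simp
  simp only [TensorProduct.tmul_zero, add_zero, zero_add, TensorProduct.tmul_smul,
    TensorProduct.smul_tmul', TensorProduct.add_tmul, TensorProduct.tmul_neg, smul_add, smul_smul,
    hp]
  have hp2 : (q : ℂ) ^ 2 * (q : ℂ)⁻¹ = q := by field_simp
  rw [hp2]
  simp only [← TensorProduct.smul_tmul']
  module

end QIB
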